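/- Let a, c ∈ ℂ satisfy a ≠ 0, c ≠ 0, a³ ≠ c³ and a³ ≠ -8c³. Then the group G of projective transformations of ℙ²(ℂ) generated by σ[x:y:z] = [x : ωy : ω²z] and τ[x:y:z] = [y : z : x] (a group isomorphic to (ℤ/3ℤ)², of order 9) maps the set of singular points of the sextic F_{a,c} to itself, and it acts freely and transitively on this set: the nine singular points (the nine cusps of 𝐁) form a single G-orbit and the stabilizer in G of each of them is trivial. -/

import Mathlib

open MvPolynomial

/-- The homogeneous sextic `F_{a,c} ∈ ℂ[X,Y,Z]`, the equation of the branch curve `B`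
of the quadruple cover `α : S → A` (viewed as a plane sextic `𝐁`). -/
noncomputable def branchSextic (a c : ℂ) : MvPolynomial (Fin 3) ℂ :=
  C (a ^ 8 * c ^ 4) * (X 0 ^ 6 + X 1 ^ 6 + X 2 ^ 6) +
  C (a ^ 2 * c * (-(4 / 27) * a ^ 9 - (2 / 9) * a ^ 6 * c ^ 3 - (64 / 9) * a ^ 3 * c ^ 6 +
      (256 / 27) * c ^ 9)) * (X 0 ^ 3 * X 1 ^ 3 + X 0 ^ 3 * X 2 ^ 3 + X 1 ^ 3 * X 2 ^ 3) +
  C (a ^ 4 * c ^ 2 * (-(2 / 3) * a ^ 6 + (16 / 3) * a ^ 3 * c ^ 3 - (32 / 3) * c ^ 6)) *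
    (X 0 * X 1 * X 2 * (X 0 ^ 3 + X 1 ^ 3 + X 2 ^ 3)) +
  C (-(1 / 27) * a ^ 12 - (92 / 27) * a ^ 9 * c ^ 3 + (112 / 9) * a ^ 6 * c ^ 6 +
      (256 / 27) * a ^ 3 * c ^ 9 - (256 / 27) * c ^ 12) * (X 0 ^ 2 * X 1 ^ 2 * X 2 ^ 2)

open scoped LinearAlgebra.Projectivization

/-- A point of `ℙ²(ℂ)` is a singular point of the sextic `F_{a,c}` if all three partial
derivatives of `F_{a,c}` vanish there. -/
def singularLocus (a c : ℂ) : Set (ℙ ℂ (Fin 3 → ℂ)) :=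
  {P | ∀ i : Fin 3, eval P.rep (pderiv i (branchSextic a c)) = 0}

/-- One sixth of the partial derivative in `x` of the dual sextic of the Hesse cubic
`x ^ 3 + y ^ 3 + z ^ 3 - 3 t x y z`; the other two are obtained by permuting the variables. -/
def dualHessePartial (t x y z : ℂ) : ℂ :=
  x ^ 5 + (2 * t ^ 3 - 1) * x ^ 2 * (y ^ 3 + z ^ 3) -
    t ^ 2 * (y * z) * (4 * x ^ 3 + y ^ 3 + z ^ 3) + (4 * t - t ^ 4) * x * y ^ 2 * z ^ 2

/-- The vanishing of all three partial derivatives of the dual sextic at `v`. -/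
def IsDualHesseSingular (t : ℂ) (v : Fin 3 → ℂ) : Prop :=
  dualHessePartial t (v 0) (v 1) (v 2) = 0 ∧ dualHessePartial t (v 1) (v 2) (v 0) = 0 ∧
    dualHessePartial t (v 2) (v 0) (v 1) = 0

/-- The parameter of the Hesse cubic dual to `F_{a,c}`. -/
noncomputable def hesseParameter (a c : ℂ) : ℂ := (4 * c ^ 3 - a ^ 3) / (3 * a ^ 2 * c)

theorem hesseParameter_cube_ne_one {a c : ℂ} (ha : a ≠ 0) (hc : c ≠ 0) (h1 : a ^ 3 ≠ c ^ 3)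
    (h2 : a ^ 3 ≠ -8 * c ^ 3) : hesseParameter a c ^ 3 ≠ 1 := by
  intro h
  have hfac : (a ^ 3 - c ^ 3) * (a ^ 3 + 8 * c ^ 3) ^ 2 = 0 := by
    rw [hesseParameter, div_pow, div_eq_one_iff_eq (by simp [ha, hc])] at h
    linear_combination -h
  rcases mul_eq_zero.1 hfac with h | h
  · exact h1 (sub_eq_zero.1 h)
  · exact h2 (by linear_combination (pow_eq_zero_iff two_ne_zero).1 h)

theorem branchSextic_eq {a c : ℂ} (ha : a ≠ 0) (hc : c ≠ 0) :
    branchSextic a c = C (a ^ 8 * c ^ 4) * ((X 0 ^ 6 + X 1 ^ 6 + X 2 ^ 6) +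
      C (4 * hesseParameter a c ^ 3 - 2) *
        (X 0 ^ 3 * X 1 ^ 3 + X 0 ^ 3 * X 2 ^ 3 + X 1 ^ 3 * X 2 ^ 3) +
      C (-6 * hesseParameter a c ^ 2) * (X 0 * X 1 * X 2 * (X 0 ^ 3 + X 1 ^ 3 + X 2 ^ 3)) +
      C (12 * hesseParameter a c - 3 * hesseParameter a c ^ 4) *
        (X 0 ^ 2 * X 1 ^ 2 * X 2 ^ 2)) := by
  have e1 : a ^ 2 * c * (-(4 / 27) * a ^ 9 - (2 / 9) * a ^ 6 * c ^ 3 - (64 / 9) * a ^ 3 * c ^ 6 +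
      (256 / 27) * c ^ 9) = a ^ 8 * c ^ 4 * (4 * hesseParameter a c ^ 3 - 2) := by
    rw [hesseParameter]; field_simp; ring
  have e2 : a ^ 4 * c ^ 2 * (-(2 / 3) * a ^ 6 + (16 / 3) * a ^ 3 * c ^ 3 - (32 / 3) * c ^ 6) =
      a ^ 8 * c ^ 4 * (-6 * hesseParameter a c ^ 2) := by
    rw [hesseParameter]; field_simp; ring
  have e3 : -(1 / 27) * a ^ 12 - (92 / 27) * a ^ 9 * c ^ 3 + (112 / 9) * a ^ 6 * c ^ 6 +
      (256 / 27) * a ^ 3 * c ^ 9 - (256 / 27) * c ^ 12 =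
      a ^ 8 * c ^ 4 * (12 * hesseParameter a c - 3 * hesseParameter a c ^ 4) := by
    rw [hesseParameter]; field_simp; ring
  rw [branchSextic, e1, e2, e3]
  simp only [C_mul (a := a ^ 8 * c ^ 4)]
  ring

theorem eval_pderiv_branchSextic {a c : ℂ} (ha : a ≠ 0) (hc : c ≠ 0) (v : Fin 3 → ℂ) :
    (∀ i, eval v (pderiv i (branchSextic a c)) = 0) ↔
      IsDualHesseSingular (hesseParameter a c) v := by
  have hk : 6 * (a ^ 8 * c ^ 4) ≠ 0 := by simp [ha, hc]
  have hX (i j : Fin 3) (h : j ≠ i) : pderiv i (X j : MvPolynomial (Fin 3) ℂ) = 0 :=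
    pderiv_X_of_ne h
  rw [branchSextic_eq ha hc, Fin.forall_fin_succ, Fin.forall_fin_two]
  generalize hesseParameter a c = t
  refine and_congr ?_ (and_congr ?_ ?_) <;>
  · refine (Eq.congr_left ?_).trans (mul_eq_zero_iff_left hk)
    simp [Derivation.leibniz, Derivation.leibniz_pow, hX, dualHessePartial]
    ring

theorem dualHessePartial_smul (t k x y z : ℂ) :
    dualHessePartial t (k * x) (k * y) (k * z) = k ^ 5 * dualHessePartial t x y z := by
  simp only [dualHessePartial]; ring

theorem isDualHesseSingular_smul {t k : ℂ} (hk : k ≠ 0) (v : Fin 3 → ℂ) :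
    IsDualHesseSingular t (k • v) ↔ IsDualHesseSingular t v := by
  simp [IsDualHesseSingular, dualHessePartial_smul, hk]

theorem mk_mem_singularLocus {a c : ℂ} (ha : a ≠ 0) (hc : c ≠ 0) (v : Fin 3 → ℂ) (hv : v ≠ 0) :
    Projectivization.mk ℂ v hv ∈ singularLocus a c ↔
      IsDualHesseSingular (hesseParameter a c) v := by
  obtain ⟨k, hk⟩ := Projectivization.exists_smul_eq_mk_rep ℂ v hv
  rw [singularLocus, Set.mem_ofPred_eq, eval_pderiv_branchSextic ha hc, ← hk]
  exact isDualHesseSingular_smul k.ne_zero v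

theorem IsDualHesseSingular.rotate {t : ℂ} {v : Fin 3 → ℂ} (h : IsDualHesseSingular t v) :
    IsDualHesseSingular t ![v 1, v 2, v 0] :=
  ⟨h.2.1, h.2.2, h.1⟩

theorem IsDualHesseSingular.diagonal {t ω : ℂ} (hω : ω ^ 3 = 1) {v : Fin 3 → ℂ}
    (h : IsDualHesseSingular t v) :
    IsDualHesseSingular t ![v 0, ω * v 1, ω ^ 2 * v 2] := by
  have h4 : ω ^ 4 = ω := by linear_combination ω * hω
  have h5 : ω ^ 5 = ω ^ 2 := by linear_combination ω ^ 2 * hω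
  have h6 : ω ^ 6 = 1 := by linear_combination (ω ^ 3 + 1) * hω
  have h7 : ω ^ 7 = ω := by linear_combination (ω ^ 4 + ω) * hω
  have h8 : ω ^ 8 = ω ^ 2 := by linear_combination (ω ^ 5 + ω ^ 2) * hω
  have h9 : ω ^ 9 = 1 := by linear_combination (ω ^ 6 + ω ^ 3 + 1) * hω
  have h10 : ω ^ 10 = ω := by linear_combination (ω ^ 7 + ω ^ 4 + ω) * hω
  obtain ⟨h0, h1, h2⟩ := h
  refine ⟨Eq.trans ?_ h0, Eq.trans ?_ (mul_eq_zero_of_right (ω ^ 2) h1),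
    Eq.trans ?_ (mul_eq_zero_of_right ω h2)⟩ <;>
  · simp [dualHessePartial]
    ring_nf
    simp only [hω, h4, h5, h6, h7, h8, h9, h10]
    ring

theorem dualHessePartial_ne_zero_of_cubes_eq {t x y z : ℂ} (ht : t ^ 3 ≠ 1) (hy : y ≠ 0)
    (hyz : y ^ 3 = z ^ 3) (hxy : x ^ 3 = y ^ 3) : dualHessePartial t x y z ≠ 0 := by
  intro h
  have hy3 : y ^ 3 ≠ 0 := pow_ne_zero 3 hy
  obtain ⟨r, hr⟩ : ∃ r, x * y * z = r * y ^ 3 := ⟨x * y * z / y ^ 3, by field_simp⟩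
  have hr3 : r ^ 3 = 1 := by
    apply mul_right_cancel₀ (pow_ne_zero 3 hy3)
    calc r ^ 3 * (y ^ 3) ^ 3 = (r * y ^ 3) ^ 3 := by ring
      _ = x ^ 3 * y ^ 3 * z ^ 3 := by rw [← hr]; ring
      _ = 1 * (y ^ 3) ^ 3 := by rw [hxy, ← hyz]; ring
  have hs : (y ^ 3) ^ 2 * (t * r ^ 2 - 1) ^ 4 = 0 := by
    have hx : x * dualHessePartial t x y z = x ^ 3 * x ^ 3 +
        (2 * t ^ 3 - 1) * x ^ 3 * (y ^ 3 + z ^ 3) -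
        t ^ 2 * (x * y * z) * (4 * x ^ 3 + y ^ 3 + z ^ 3) +
        (4 * t - t ^ 4) * (x * y * z) ^ 2 := by
      rw [dualHessePartial]; ring
    rw [h, mul_zero, hr, hxy, ← hyz] at hx
    linear_combination hx + (y ^ 3) ^ 2 * (t ^ 4 * r ^ 2 * (r ^ 3 + 1) - 4 * t ^ 3 * (r ^ 3 + 1) +
      6 * t ^ 2 * r) * hr3
  have h1 : t * r ^ 2 - 1 = 0 := by simpa [hy] using hs
  apply ht
  calc t ^ 3 = (t * r ^ 2) ^ 3 := by
        rw [mul_pow, ← pow_mul, mul_comm 2, pow_mul, hr3, one_pow, mul_one]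
    _ = 1 := by rw [sub_eq_zero.1 h1, one_pow]

theorem dualHesse_cusp_of_cubes_eq {t x y z : ℂ} (ht : t ^ 3 ≠ 1)
    (h : x ≠ 0 ∨ y ≠ 0 ∨ z ≠ 0) (hx : dualHessePartial t x y z = 0)
    (hy : dualHessePartial t y z x = 0) (hyz : y ^ 3 = z ^ 3) :
    y ≠ 0 ∧ x * y * z = t * y ^ 3 := by
  have hy0 : y ≠ 0 := by
    rintro rfl
    have hz : z = 0 := by simpa using hyz.symm
    subst hz
    have : x = 0 := by simpa [dualHessePartial] using hx
    simp_all
  refine ⟨hy0, ?_⟩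
  have hxy : x ^ 3 - y ^ 3 ≠ 0 := fun hxy =>
    dualHessePartial_ne_zero_of_cubes_eq ht hy0 hyz (sub_eq_zero.1 hxy) hx
  have hy3 : y ^ 3 ≠ 0 := pow_ne_zero 3 hy0
  obtain ⟨p, hp⟩ : ∃ p, x * y * z = p * y ^ 3 := ⟨x * y * z / y ^ 3, by field_simp⟩
  have hfac : (x ^ 3 - y ^ 3) * (x ^ 3 + y ^ 3 + (2 * t ^ 3 - 1) * z ^ 3 -
      3 * t ^ 2 * (x * y * z)) = 0 := by
    simp only [dualHessePartial] at hx hy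
    linear_combination x * hx - y * hy
  have hA : x ^ 3 = (3 * t ^ 2 * p - 2 * t ^ 3) * y ^ 3 := by
    have := (mul_eq_zero.1 hfac).resolve_left hxy
    rw [hp, ← hyz] at this
    linear_combination this
  have hp3 : (p - t) ^ 2 * (p + 2 * t) = 0 := by
    apply (mul_eq_zero.1 (?_ : (y ^ 3) ^ 3 * _ = 0)).resolve_left (pow_ne_zero 3 hy3)
    have : x ^ 3 * y ^ 3 * z ^ 3 = (p * y ^ 3) ^ 3 := by rw [← hp]; ring
    rw [hA, ← hyz] at this
    linear_combination -this
  rcases mul_eq_zero.1 hp3 with h0 | h0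
  · rw [hp, sub_eq_zero.1 ((pow_eq_zero_iff two_ne_zero).1 h0)]
  · have hp' : p = -2 * t := by linear_combination h0
    subst hp'
    have hyy : y * dualHessePartial t y z x = y ^ 3 * y ^ 3 +
        (2 * t ^ 3 - 1) * y ^ 3 * (z ^ 3 + x ^ 3) -
        t ^ 2 * (x * y * z) * (4 * y ^ 3 + z ^ 3 + x ^ 3) +
        (4 * t - t ^ 4) * (x * y * z) ^ 2 := by
      rw [dualHessePartial]; ring
    rw [hy, mul_zero, hp, hA, ← hyz] at hyy
    have h3 : (36 * (y ^ 3) ^ 2) * (t ^ 3 * (1 - t ^ 3)) = 0 := by linear_combination -hyy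
    have h4 := (mul_eq_zero.1 h3).resolve_left (by simp [hy0])
    have h5 := (mul_eq_zero.1 h4).resolve_right (sub_ne_zero.2 ht.symm)
    rw [hp, (pow_eq_zero_iff three_ne_zero).1 h5]
    ring

theorem IsDualHesseSingular.exists_cubes_eq {t : ℂ} (ht : t ^ 3 ≠ 1) {v : Fin 3 → ℂ}
    (h : IsDualHesseSingular t v) :
    v 1 ^ 3 = v 2 ^ 3 ∨ v 2 ^ 3 = v 0 ^ 3 ∨ v 0 ^ 3 = v 1 ^ 3 := by
  obtain ⟨hx, hy, hz⟩ := h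
  generalize v 0 = x, v 1 = y, v 2 = z at *
  by_contra! h
  obtain ⟨hyz, hzx, hxy⟩ := h
  simp only [dualHessePartial] at hx hy hz
  have h1 : (y ^ 3 - z ^ 3) * (y ^ 3 + z ^ 3 + (2 * t ^ 3 - 1) * x ^ 3 -
      3 * t ^ 2 * (x * y * z)) = 0 := by
    linear_combination y * hy - z * hz
  have h2 : (z ^ 3 - x ^ 3) * (z ^ 3 + x ^ 3 + (2 * t ^ 3 - 1) * y ^ 3 -
      3 * t ^ 2 * (x * y * z)) = 0 := by
    linear_combination z * hz - x * hx
  have h1' := (mul_eq_zero.1 h1).resolve_left (sub_ne_zero.2 hyz)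
  have h2' := (mul_eq_zero.1 h2).resolve_left (sub_ne_zero.2 hzx)
  have h3 : (t ^ 3 - 1) * (x ^ 3 - y ^ 3) = 0 := by linear_combination (h1' - h2') / 2
  exact hxy (sub_eq_zero.1 ((mul_eq_zero.1 h3).resolve_left (sub_ne_zero.2 ht)))

theorem exists_pow_of_cusp {ω t x y z : ℂ} (hω : IsPrimitiveRoot ω 3) (hy : y ≠ 0)
    (hyz : y ^ 3 = z ^ 3) (hxyz : x * y * z = t * y ^ 3) :
    ∃ i : ℕ, ∃ k : ℂ, k * t = x ∧ k * ω ^ i = y ∧ k * ω ^ (2 * i) = z := by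
  have hr : (z / y) ^ 3 = 1 := by rw [div_pow, ← hyz, div_self (pow_ne_zero 3 hy)]
  obtain ⟨i, -, hi⟩ := hω.eq_pow_of_pow_eq_one hr
  have hz : z = ω ^ i * y := by rw [hi]; field_simp
  have h3 : (ω ^ i) ^ 3 = 1 := by rw [hi, hr]
  have hx : x * ω ^ i = t * y := by
    apply mul_right_cancel₀ (pow_ne_zero 2 hy)
    rw [hz] at hxyz
    linear_combination hxyz
  refine ⟨i, (ω ^ i) ^ 2 * y, ?_, ?_, ?_⟩
  · linear_combination -(ω ^ i) ^ 2 * hx + x * h3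
  · linear_combination y * h3
  · rw [mul_comm 2 i, pow_mul, hz]
    linear_combination y * ω ^ i * h3

theorem diagonal_ne_zero {ω : ℂ} (hω : ω ≠ 0) {v : Fin 3 → ℂ} (hv : v ≠ 0) :
    ![v 0, ω * v 1, ω ^ 2 * v 2] ≠ 0 := by
  contrapose! hv
  ext i
  have := congrFun hv i
  fin_cases i <;> simpa [hω] using this

theorem rotate_ne_zero {v : Fin 3 → ℂ} (hv : v ≠ 0) : ![v 1, v 2, v 0] ≠ 0 := by
  contrapose! hv
  ext i
  fin_cases i
  · exact congrFun hv 2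
  · exact congrFun hv 0
  · exact congrFun hv 1

/-- The group `G ≅ (ℤ/3ℤ)²` of projective transformations generated by
`σ[x:y:z] = [x:ωy:ω²z]` and `τ[x:y:z] = [y:z:x]` maps the set of singular points of
`F_{a,c}` to itself and acts freely and transitively on it: the nine cusps of `𝐁` form a
single `G`-orbit with trivial stabilizers. -/
theorem heisenberg_action_on_cusps (ω : ℂ) (hω : IsPrimitiveRoot ω 3) (a c : ℂ)
    (ha : a ≠ 0) (hc : c ≠ 0) (h1 : a ^ 3 ≠ c ^ 3) (h2 : a ^ 3 ≠ -8 * c ^ 3)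
    (σ τ : ℙ ℂ (Fin 3 → ℂ) → ℙ ℂ (Fin 3 → ℂ))
    (hσ : ∀ (v : Fin 3 → ℂ) (hv : v ≠ 0) (hw : ![v 0, ω * v 1, ω ^ 2 * v 2] ≠ 0),
      σ (Projectivization.mk ℂ v hv) =
        Projectivization.mk ℂ ![v 0, ω * v 1, ω ^ 2 * v 2] hw)
    (hτ : ∀ (v : Fin 3 → ℂ) (hv : v ≠ 0) (hw : ![v 1, v 2, v 0] ≠ 0),
      τ (Projectivization.mk ℂ v hv) = Projectivization.mk ℂ ![v 1, v 2, v 0] hw) :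
    -- `σ` and `τ` generate a group isomorphic to `(ℤ/3ℤ)²`, of order 9 …
    (∀ P, σ (τ P) = τ (σ P)) ∧ (∀ P, σ^[3] P = P) ∧ (∀ P, τ^[3] P = P) ∧
    -- … mapping the singular locus to itself …
    (∀ P ∈ singularLocus a c, σ P ∈ singularLocus a c ∧ τ P ∈ singularLocus a c) ∧
    -- … transitively: the nine singular points form a single orbit …
    (∀ P ∈ singularLocus a c, ∀ Q ∈ singularLocus a c, ∃ m n : ℕ, σ^[m] (τ^[n] P) = Q) ∧
    -- … and freely: the stabilizer of each singular point is trivial.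
    (∀ P ∈ singularLocus a c, ∀ m n : ℕ, m < 3 → n < 3 → σ^[m] (τ^[n] P) = P →
      m = 0 ∧ n = 0) := by
  have hω0 : ω ≠ 0 := hω.ne_zero three_ne_zero
  have hω3 : ω ^ 3 = 1 := hω.pow_eq_one
  have hσ' v hv := hσ v hv (diagonal_ne_zero hω0 hv)
  have hτ' v hv := hτ v hv (rotate_ne_zero hv)
  have hcomm : Function.Commute σ τ := by
    intro P
    induction P using Projectivization.ind with | h v hv => ?_
    rw [hτ', hσ', hσ', hτ', Projectivization.mk_eq_mk_iff']
    refine ⟨ω ^ 2, ?_⟩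
    ext i
    fin_cases i <;> simp
    · linear_combination v 1 * hω3
    · linear_combination ω * v 2 * hω3
  have hσ3 : ∀ P, σ^[3] P = P := by
    intro P
    induction P using Projectivization.ind with | h v hv => ?_
    simp only [Function.iterate_succ, Function.iterate_zero, Function.comp_apply, hσ', id_eq]
    congr 1
    ext i
    fin_cases i <;> simp
    · linear_combination v 1 * hω3
    · linear_combination (ω ^ 3 + 1) * v 2 * hω3
  have hτ3 : ∀ P, τ^[3] P = P := by
    intro P
    induction P using Projectivization.ind with | h v hv => ?_
    simp only [Function.iterate_succ, Function.iterate_zero, Function.comp_apply, hτ', id_eq]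
    congr 1
    ext i
    fin_cases i <;> rfl
  have hσ3n : ∀ n P, σ^[3 * n] P = P := fun n P => by
    rw [Function.iterate_mul, show σ^[3] = id from funext hσ3, Function.iterate_id, id]
  have hτ3n : ∀ n P, τ^[3 * n] P = P := fun n P => by
    rw [Function.iterate_mul, show τ^[3] = id from funext hτ3, Function.iterate_id, id]
  have hσn : ∀ (n : ℕ) (v : Fin 3 → ℂ) (hv : v ≠ 0), ∃ hw,
      σ^[n] (Projectivization.mk ℂ v hv) =
        Projectivization.mk ℂ ![v 0, ω ^ n * v 1, ω ^ (2 * n) * v 2] hw := by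
    intro n v hv
    induction n with
    | zero =>
      have : ![v 0, ω ^ 0 * v 1, ω ^ (2 * 0) * v 2] = v := by
        ext i
        fin_cases i <;> simp
      exact ⟨by rwa [this], by simp only [this, Function.iterate_zero, id]⟩
    | succ n ih =>
      obtain ⟨hw, ih⟩ := ih
      have : ![v 0, ω ^ (n + 1) * v 1, ω ^ (2 * (n + 1)) * v 2] =
          ![v 0, ω * (ω ^ n * v 1), ω ^ 2 * (ω ^ (2 * n) * v 2)] := by
        congr! 2 <;> ring_nf
      refine ⟨this ▸ diagonal_ne_zero hω0 hw, ?_⟩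
      rw [Function.iterate_succ_apply', ih, hσ']
      simp only [this]
      rfl
  have ht := hesseParameter_cube_ne_one ha hc h1 h2
  have hmem := mk_mem_singularLocus ha hc
  generalize hesseParameter a c = t at ht hmem
  have hP0 : ![t, 1, 1] ≠ 0 := fun h => one_ne_zero (congrFun h 1)
  have hστ : ∀ P ∈ singularLocus a c, σ P ∈ singularLocus a c ∧ τ P ∈ singularLocus a c := by
    intro P hP
    induction P using Projectivization.ind with | h v hv => ?_
    rw [hmem] at hP
    rw [hσ', hτ', hmem, hmem]
    exact ⟨hP.diagonal hω3, hP.rotate⟩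
  have hcusp : ∀ (v : Fin 3 → ℂ) (hv : v ≠ 0), IsDualHesseSingular t v → v 1 ^ 3 = v 2 ^ 3 →
      ∃ i, Projectivization.mk ℂ v hv = σ^[i] (Projectivization.mk ℂ ![t, 1, 1] hP0) := by
    intro v hv hs heq
    have hne : v 0 ≠ 0 ∨ v 1 ≠ 0 ∨ v 2 ≠ 0 := by
      contrapose! hv
      ext i
      fin_cases i
      exacts [hv.1, hv.2.1, hv.2.2]
    obtain ⟨hy, hxyz⟩ := dualHesse_cusp_of_cubes_eq ht hne hs.1 hs.2.1 heq
    obtain ⟨i, k, hk0, hk1, hk2⟩ := exists_pow_of_cusp hω hy heq hxyz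
    obtain ⟨hw, hi⟩ := hσn i _ hP0
    refine ⟨i, ?_⟩
    rw [hi, Projectivization.mk_eq_mk_iff']
    refine ⟨k, ?_⟩
    ext j
    fin_cases j <;> simp [hk0, hk1, hk2]
  have horbit : ∀ P ∈ singularLocus a c, ∃ n i,
      τ^[n] P = σ^[i] (Projectivization.mk ℂ ![t, 1, 1] hP0) := by
    intro P hP
    induction P using Projectivization.ind with | h v hv => ?_
    rw [hmem] at hP
    rcases hP.exists_cubes_eq ht with h | h | h
    · exact ⟨0, hcusp v hv hP h⟩
    · obtain ⟨i, hi⟩ := hcusp _ (rotate_ne_zero hv) hP.rotate h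
      exact ⟨1, i, by rw [← hi, Function.iterate_one, hτ']⟩
    · obtain ⟨i, hi⟩ := hcusp _ (rotate_ne_zero (rotate_ne_zero hv)) hP.rotate.rotate h
      refine ⟨2, i, ?_⟩
      rw [← hi, Function.iterate_succ_apply, Function.iterate_one, hτ', hτ']
  have hcomm' := fun m n P => (hcomm.iterate_iterate m n) P
  refine ⟨hcomm, hσ3, hτ3, hστ, ?_, ?_⟩
  · intro P hP Q hQ
    obtain ⟨n, i, hn⟩ := horbit P hP
    obtain ⟨k, j, hk⟩ := horbit Q hQ
    refine ⟨j + 2 * i, 2 * k + n, ?_⟩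
    rw [Function.iterate_add_apply τ, hn, hcomm', ← Function.iterate_add_apply σ,
      show j + 2 * i + i = j + 3 * i by ring, Function.iterate_add_apply, hσ3n, ← hk,
      ← Function.iterate_add_apply, show 2 * k + k = 3 * k by ring, hτ3n]
  · intro P hP m n _ hn3 h
    obtain ⟨k, i, hk⟩ := horbit P hP
    have hfix : σ^[m] (τ^[n] (Projectivization.mk ℂ ![t, 1, 1] hP0)) =
        Projectivization.mk ℂ ![t, 1, 1] hP0 := by
      have hinj : Function.Injective σ^[i] := by
        refine Function.LeftInverse.injective (g := σ^[2 * i]) fun Q => ?_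
        rw [← Function.iterate_add_apply, show 2 * i + i = 3 * i by ring, hσ3n]
      apply hinj
      rw [← Function.iterate_add_apply, add_comm, Function.iterate_add_apply, hcomm' i n, ← hk,
        ← Function.iterate_add_apply τ, add_comm, Function.iterate_add_apply τ, hcomm', h]
    interval_cases n
    · obtain ⟨hw, hm⟩ := hσn m _ hP0
      rw [Function.iterate_zero, id, hm, Projectivization.mk_eq_mk_iff'] at hfix
      obtain ⟨l, hl⟩ := hfix
      have e1 : l = ω ^ m := by simpa using congrFun hl 1
      have e2 : l = ω ^ (2 * m) := by simpa using congrFun hl 2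
      have e3 : ω ^ m = 1 := by
        apply mul_left_cancel₀ (pow_ne_zero m hω0)
        rw [← pow_add, ← two_mul, ← e2, e1, mul_one]
      have := hω.dvd_of_pow_eq_one m e3
      omega
    · exfalso
      obtain ⟨hw, hm⟩ := hσn m _ (rotate_ne_zero hP0)
      rw [Function.iterate_one, hτ', hm, Projectivization.mk_eq_mk_iff'] at hfix
      obtain ⟨l, hl⟩ := hfix
      have e0 : l * t = 1 := by simpa using congrFun hl 0
      have e1 : l = ω ^ m := by simpa using congrFun hl 1
      apply ht
      calc t ^ 3 = (ω ^ 3) ^ m * t ^ 3 := by rw [hω3, one_pow, one_mul]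
        _ = (l * t) ^ 3 := by rw [e1]; ring
        _ = 1 := by rw [e0, one_pow]
    · exfalso
      obtain ⟨hw, hm⟩ := hσn m _ (rotate_ne_zero (rotate_ne_zero hP0))
      rw [Function.iterate_succ_apply, Function.iterate_one, hτ', hτ', hm,
        Projectivization.mk_eq_mk_iff'] at hfix
      obtain ⟨l, hl⟩ := hfix
      have e0 : l * t = 1 := by simpa using congrFun hl 0
      have e2 : l = ω ^ (2 * m) := by simpa using congrFun hl 2
      apply ht
      calc t ^ 3 = (ω ^ 3) ^ (2 * m) * t ^ 3 := by rw [hω3, one_pow, one_mul]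
        _ = (l * t) ^ 3 := by rw [e2]; ring
        _ = 1 := by rw [e0, one_pow]
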